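/- Graded cancellation: Let (C, d) be a based chain complex over ℚ with distinguished finite bases B_n, equipped with an auxiliary ℤ²-grading in which every basis element is homogeneous and which is preserved by d. Suppose x ∈ B_n and y ∈ B_{n−1} satisfy (d x)_y = 1. Then y has the same auxiliary bidegree as x, the cancelled complex (C′, d′) of the cancellation lemma inherits an auxiliary ℤ²-grading (every element of B_m \ {x, y} remains homogeneous and d′ preserves the grading), and for every n and every bidegree (j, k) the homology of the (j,k)-graded subcomplex of C in degree n is isomorphic to the homology of the (j,k)-graded subcomplex of C′ in degree n. -/

import Mathlib

noncomputable section

/- A based chain complex over `ℚ` is given by a family `B : ℤ → Type` of finite basis sets,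
with chain groups `C m = B m →₀ ℚ` and differentials `d m : C (m+1) →ₗ[ℚ] C m`
satisfying `d ∘ d = 0`.  For `v : B m →₀ ℚ` and `b : B m`, the coefficient `v_b` is `v b`.
An auxiliary `ℤ²`-grading assigns a bidegree `gr m b : ℤ × ℤ` to each basis element. -/

variable (B : ℤ → Type)
variable (d : ∀ m : ℤ, (B (m + 1) →₀ ℚ) →ₗ[ℚ] (B m →₀ ℚ))
variable (n : ℤ)

/-- Cast of basis elements along an equality of degrees. -/
def bcast {a b : ℤ} (h : a = b) : B a → B b := fun t => cast (congrArg B h) t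

/-- Cast of chain groups along an equality of degrees. -/
def fcast {a b : ℤ} (h : a = b) : (B a →₀ ℚ) →ₗ[ℚ] (B b →₀ ℚ) :=
  Finsupp.lmapDomain ℚ ℚ (bcast B h)

variable (x : B (n + 1)) (y : B n)

/-- The basis of the cancelled complex: all distinguished basis elements except `x` and `y`. -/
def Bc (m : ℤ) : Type :=
  {b : B m // (∀ h : m = n + 1, bcast B h b ≠ x) ∧ (∀ h : m = n, bcast B h b ≠ y)}

/-- The inclusion `C′_m → C_m` induced by `B_m \ {x, y} ⊆ B_m`. -/
def incl (m : ℤ) : (Bc B n x y m →₀ ℚ) →ₗ[ℚ] (B m →₀ ℚ) :=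
  Finsupp.lmapDomain ℚ ℚ Subtype.val

/-- The projection `P : C_m → C′_m` deleting the `x`- and `y`-coordinates. -/
def proj (m : ℤ) : (B m →₀ ℚ) →ₗ[ℚ] (Bc B n x y m →₀ ℚ) :=
  Finsupp.lcomapDomain Subtype.val Subtype.val_injective

/-- The coefficient of `y` (interpreted as `0` in degrees other than that of `y`). -/
def coefY (m : ℤ) : (B m →₀ ℚ) →ₗ[ℚ] ℚ :=
  if h : m = n then (Finsupp.lapply y).comp (fcast B h) else 0

/-- The vector `d x`, placed in degree `m` (zero in other degrees). -/
def dxAt (m : ℤ) : B m →₀ ℚ :=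
  if h : m = n then fcast B h.symm (d n (Finsupp.single x 1)) else 0

/-- The differential of the cancelled complex: `d′(a) = P (d a − (d a)_y • d x)`. -/
def d' (m : ℤ) : (Bc B n x y (m + 1) →₀ ℚ) →ₗ[ℚ] (Bc B n x y m →₀ ℚ) :=
  (proj B n x y m).comp
    (((d m).comp (incl B n x y (m + 1))) -
      (LinearMap.toSpanSingleton ℚ _ (dxAt B d n x m)).comp
        ((coefY B n y m).comp ((d m).comp (incl B n x y (m + 1)))))

variable (gr : ∀ m : ℤ, B m → ℤ × ℤ)

/-- The basis of the `(j,k)`-graded piece of `C_m`. -/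
def Bg (jk : ℤ × ℤ) (m : ℤ) : Type := {b : B m // gr m b = jk}

/-- The inclusion of the `(j,k)`-graded piece of `C_m`. -/
def inclG (jk : ℤ × ℤ) (m : ℤ) : (Bg B gr jk m →₀ ℚ) →ₗ[ℚ] (B m →₀ ℚ) :=
  Finsupp.lmapDomain ℚ ℚ Subtype.val

/-- The projection onto the `(j,k)`-graded piece of `C_m`. -/
def projG (jk : ℤ × ℤ) (m : ℤ) : (B m →₀ ℚ) →ₗ[ℚ] (Bg B gr jk m →₀ ℚ) :=
  Finsupp.lcomapDomain Subtype.val Subtype.val_injective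

/-- The differential of the `(j,k)`-graded subcomplex of `C`. -/
def dG (jk : ℤ × ℤ) (m : ℤ) : (Bg B gr jk (m + 1) →₀ ℚ) →ₗ[ℚ] (Bg B gr jk m →₀ ℚ) :=
  (projG B gr jk m).comp ((d m).comp (inclG B gr jk (m + 1)))

/-- The basis of the `(j,k)`-graded piece of the cancelled complex `C′_m`
(with the inherited grading). -/
def BcG (jk : ℤ × ℤ) (m : ℤ) : Type := {b : Bc B n x y m // gr m b.1 = jk}

/-- The inclusion of the `(j,k)`-graded piece of `C′_m`. -/
def inclG' (jk : ℤ × ℤ) (m : ℤ) : (BcG B n x y gr jk m →₀ ℚ) →ₗ[ℚ] (Bc B n x y m →₀ ℚ) :=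
  Finsupp.lmapDomain ℚ ℚ Subtype.val

/-- The projection onto the `(j,k)`-graded piece of `C′_m`. -/
def projG' (jk : ℤ × ℤ) (m : ℤ) : (Bc B n x y m →₀ ℚ) →ₗ[ℚ] (BcG B n x y gr jk m →₀ ℚ) :=
  Finsupp.lcomapDomain Subtype.val Subtype.val_injective

/-- The differential of the `(j,k)`-graded subcomplex of the cancelled complex `C′`. -/
def dG' (jk : ℤ × ℤ) (m : ℤ) :
    (BcG B n x y gr jk (m + 1) →₀ ℚ) →ₗ[ℚ] (BcG B n x y gr jk m →₀ ℚ) :=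
  (projG' B n x y gr jk m).comp ((d' B d n x y m).comp (inclG' B n x y gr jk (m + 1)))

/-- The homology of a pair of composable linear maps, `ker g / im f`. -/
abbrev homologyOf {M N P : Type} [AddCommGroup M] [Module ℚ M] [AddCommGroup N] [Module ℚ N]
    [AddCommGroup P] [Module ℚ P] (f : M →ₗ[ℚ] N) (g : N →ₗ[ℚ] P) : Type :=
  ↥(LinearMap.ker g) ⧸ (LinearMap.range f).comap (LinearMap.ker g).subtype

section Restrict

variable {A A' A'' : Type}

/-- The inclusion of the span of a subset of a basis. -/
def subIncl (p : A → Prop) : ({a // p a} →₀ ℚ) →ₗ[ℚ] (A →₀ ℚ) :=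
  Finsupp.lmapDomain ℚ ℚ Subtype.val

/-- The coordinate projection onto the span of a subset of a basis. -/
def subProj (p : A → Prop) : (A →₀ ℚ) →ₗ[ℚ] ({a // p a} →₀ ℚ) :=
  Finsupp.lcomapDomain Subtype.val Subtype.val_injective

theorem subProj_apply (p : A → Prop) (v : A →₀ ℚ) (b : {a // p a}) :
    subProj p v b = v b.1 := rfl

theorem subIncl_apply_of_mem (p : A → Prop) (v : {a // p a} →₀ ℚ) (b : {a // p a}) :
    subIncl p v b.1 = v b :=
  Finsupp.mapDomain_apply Subtype.val_injective v b

theorem subIncl_apply_of_not_mem (p : A → Prop) (v : {a // p a} →₀ ℚ) {b : A} (hb : ¬ p b) :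
    subIncl p v b = 0 :=
  Finsupp.mapDomain_of_notMem_range v b (by
    rintro ⟨c, rfl⟩
    exact hb c.2)

theorem subIncl_single (p : A → Prop) (b : {a // p a}) (r : ℚ) :
    subIncl p (Finsupp.single b r) = Finsupp.single b.1 r :=
  Finsupp.mapDomain_single

theorem subProj_comp_subIncl (p : A → Prop) : subProj p ∘ₗ subIncl p = LinearMap.id :=
  LinearMap.ext fun v => Finsupp.ext fun b => subIncl_apply_of_mem p v b

/-- A linear map preserves the gradings `g` and `g'` of the bases. -/
def IsGraded (g : A → ℤ × ℤ) (g' : A' → ℤ × ℤ) (T : (A →₀ ℚ) →ₗ[ℚ] (A' →₀ ℚ)) : Prop :=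
  ∀ a c, g' c ≠ g a → T (Finsupp.single a 1) c = 0

/-- The component of a linear map in one bidegree. -/
def gradedRestrict (g : A → ℤ × ℤ) (g' : A' → ℤ × ℤ) (jk : ℤ × ℤ)
    (T : (A →₀ ℚ) →ₗ[ℚ] (A' →₀ ℚ)) :
    ({a // g a = jk} →₀ ℚ) →ₗ[ℚ] ({a // g' a = jk} →₀ ℚ) :=
  subProj (fun a => g' a = jk) ∘ₗ T ∘ₗ subIncl (fun a => g a = jk)

variable {g : A → ℤ × ℤ} {g' : A' → ℤ × ℤ} {g'' : A'' → ℤ × ℤ}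

theorem IsGraded.subIncl_subProj {T : (A →₀ ℚ) →ₗ[ℚ] (A' →₀ ℚ)} (hT : IsGraded g g' T)
    (jk : ℤ × ℤ) :
    subIncl (fun a => g' a = jk) ∘ₗ subProj (fun a => g' a = jk) ∘ₗ T ∘ₗ
      subIncl (fun a => g a = jk) = T ∘ₗ subIncl (fun a => g a = jk) := by
  refine Finsupp.lhom_ext' fun a => LinearMap.ext_ring (Finsupp.ext fun c => ?_)
  simp only [LinearMap.comp_apply, Finsupp.lsingle_apply, subIncl_single]
  by_cases hc : g' c = jk
  · exact subIncl_apply_of_mem (fun a => g' a = jk) _ ⟨c, hc⟩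
  · rw [subIncl_apply_of_not_mem (fun a => g' a = jk) _ hc, hT _ _ (by rwa [a.2])]

theorem gradedRestrict_comp (jk : ℤ × ℤ) (T : (A' →₀ ℚ) →ₗ[ℚ] (A'' →₀ ℚ))
    {S : (A →₀ ℚ) →ₗ[ℚ] (A' →₀ ℚ)} (hS : IsGraded g g' S) :
    gradedRestrict g g'' jk (T ∘ₗ S) =
      gradedRestrict g' g'' jk T ∘ₗ gradedRestrict g g' jk S := by
  simp only [gradedRestrict, LinearMap.comp_assoc]
  rw [hS.subIncl_subProj]

theorem gradedRestrict_id (jk : ℤ × ℤ) :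
    gradedRestrict g g jk LinearMap.id = LinearMap.id :=
  subProj_comp_subIncl _

theorem gradedRestrict_add (jk : ℤ × ℤ) (T S : (A →₀ ℚ) →ₗ[ℚ] (A' →₀ ℚ)) :
    gradedRestrict g g' jk (T + S) = gradedRestrict g g' jk T + gradedRestrict g g' jk S := by
  simp only [gradedRestrict, LinearMap.add_comp, LinearMap.comp_add]

theorem isGraded_id : IsGraded g g LinearMap.id := fun _ _ h =>
  Finsupp.single_eq_of_ne fun e => h (congrArg g e)

theorem IsGraded.sub {T S : (A →₀ ℚ) →ₗ[ℚ] (A' →₀ ℚ)} (hT : IsGraded g g' T)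
    (hS : IsGraded g g' S) : IsGraded g g' (T - S) := fun a c h => by
  rw [LinearMap.sub_apply, Finsupp.sub_apply, hT a c h, hS a c h, sub_zero]

theorem IsGraded.comp {T : (A' →₀ ℚ) →ₗ[ℚ] (A'' →₀ ℚ)} {S : (A →₀ ℚ) →ₗ[ℚ] (A' →₀ ℚ)}
    (hT : IsGraded g' g'' T) (hS : IsGraded g g' S) : IsGraded g g'' (T ∘ₗ S) := by
  intro a c h
  have hSa := LinearMap.congr_fun (hS.subIncl_subProj (g a)) (Finsupp.single ⟨a, rfl⟩ 1)
  simp only [LinearMap.comp_apply, subIncl_single] at hSa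
  have hT' := LinearMap.congr_fun (hT.subIncl_subProj (g a))
    (subProj (fun b => g' b = g a) (S (Finsupp.single a 1)))
  simp only [LinearMap.comp_apply, hSa] at hT'
  rw [LinearMap.comp_apply, ← hT', subIncl_apply_of_not_mem (fun b => g'' b = g a) _ h]

theorem isGraded_subIncl (p : A → Prop) : IsGraded (fun a : {a // p a} => g a.1) g (subIncl p) :=
  fun a c h => by
    rw [subIncl_single]
    exact Finsupp.single_eq_of_ne fun e => h (congrArg g e)

theorem isGraded_subProj (p : A → Prop) : IsGraded g (fun a : {a // p a} => g a.1) (subProj p) :=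
  fun a c h => by
    rw [subProj_apply]
    exact Finsupp.single_eq_of_ne fun e => h (congrArg g e)

end Restrict

/-- A deformation retraction of short pieces of complexes induces an isomorphism on homology. -/
theorem nonempty_homologyOf_equiv {M N P M' N' P' : Type}
    [AddCommGroup M] [Module ℚ M] [AddCommGroup N] [Module ℚ N] [AddCommGroup P] [Module ℚ P]
    [AddCommGroup M'] [Module ℚ M'] [AddCommGroup N'] [Module ℚ N']
    [AddCommGroup P'] [Module ℚ P']
    {f : M →ₗ[ℚ] N} {g : N →ₗ[ℚ] P} {f' : M' →ₗ[ℚ] N'} {g' : N' →ₗ[ℚ] P'}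
    (FM : M →ₗ[ℚ] M') (F : N →ₗ[ℚ] N') (FP : P →ₗ[ℚ] P')
    (GM : M' →ₗ[ℚ] M) (G : N' →ₗ[ℚ] N) (GP : P' →ₗ[ℚ] P)
    (h : N →ₗ[ℚ] M) (k : P →ₗ[ℚ] N)
    (hFf : F ∘ₗ f = f' ∘ₗ FM) (hFg : g' ∘ₗ F = FP ∘ₗ g)
    (hGf : G ∘ₗ f' = f ∘ₗ GM) (hGg : g ∘ₗ G = GP ∘ₗ g')
    (hFG : F ∘ₗ G = LinearMap.id) (hGF : G ∘ₗ F + (f ∘ₗ h + k ∘ₗ g) = LinearMap.id) :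
    Nonempty (homologyOf f g ≃ₗ[ℚ] homologyOf f' g') := by
  have kerF : ∀ v ∈ LinearMap.ker g, F v ∈ LinearMap.ker g' := fun v hv => by
    have := LinearMap.congr_fun hFg v
    simpa [LinearMap.mem_ker.1 hv] using this
  have kerG : ∀ v ∈ LinearMap.ker g', G v ∈ LinearMap.ker g := fun v hv => by
    have := LinearMap.congr_fun hGg v
    simpa [LinearMap.mem_ker.1 hv] using this
  refine ⟨LinearEquiv.ofLinearMap
    (Submodule.mapQ _ _ (F.restrict kerF) ?_) (Submodule.mapQ _ _ (G.restrict kerG) ?_) ?_ ?_⟩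
  · rintro ⟨v, hv⟩ ⟨u, rfl⟩
    exact ⟨FM u, (LinearMap.congr_fun hFf u).symm⟩
  · rintro ⟨v, hv⟩ ⟨u, rfl⟩
    exact ⟨GM u, (LinearMap.congr_fun hGf u).symm⟩
  · refine Submodule.linearMap_qext _ (LinearMap.ext fun v => ?_)
    simp only [LinearMap.comp_apply, Submodule.mkQ_apply, Submodule.mapQ_apply, LinearMap.id_apply]
    congr 1
    exact Subtype.ext (LinearMap.congr_fun hFG v.1)
  · refine Submodule.linearMap_qext _ (LinearMap.ext fun v => ?_)
    simp only [LinearMap.comp_apply, Submodule.mkQ_apply, Submodule.mapQ_apply, LinearMap.id_apply]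
    refine (Submodule.Quotient.eq _).2 ⟨-h v.1, ?_⟩
    have hv := LinearMap.congr_fun hGF v.1
    simp only [LinearMap.add_apply, LinearMap.comp_apply, LinearMap.mem_ker.1 v.2, map_zero,
      add_zero, LinearMap.id_apply] at hv
    change f (-h v.1) = G (F v.1) - v.1
    rw [map_neg, eq_sub_iff_add_eq, neg_add_eq_iff_eq_add, add_comm, hv]

/-- The basis vector `x`, placed in degree `m` (zero in other degrees). -/
def xAt (m : ℤ) : B m →₀ ℚ :=
  if h : m = n + 1 then Finsupp.single (bcast B h.symm x) 1 else 0

/-- The map `v ↦ v_y • x`. -/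
def yToX (m : ℤ) : (B m →₀ ℚ) →ₗ[ℚ] (B (m + 1) →₀ ℚ) :=
  (LinearMap.toSpanSingleton ℚ _ (xAt B n x (m + 1))) ∘ₗ coefY B n y m

theorem fcast_rfl (m : ℤ) : fcast B (rfl : m = m) = LinearMap.id :=
  Finsupp.lmapDomain_id ℚ ℚ

theorem coefY_self (v : B n →₀ ℚ) : coefY B n y n v = v y := by
  simp [coefY, fcast_rfl]

theorem coefY_of_ne {m : ℤ} (h : m ≠ n) : coefY B n y m = 0 := dif_neg h

theorem xAt_self : xAt B n x (n + 1) = Finsupp.single x 1 := dif_pos rfl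

theorem xAt_of_ne {m : ℤ} (h : m ≠ n + 1) : xAt B n x m = 0 := dif_neg h

theorem yToX_apply (m : ℤ) (v : B m →₀ ℚ) :
    yToX B n x y m v = coefY B n y m v • xAt B n x (m + 1) := rfl

theorem dxAt_eq (m : ℤ) : dxAt B d n x m = d m (xAt B n x (m + 1)) := by
  by_cases h : m = n
  · subst h
    simp [dxAt, fcast_rfl, xAt_self]
  · rw [xAt_of_ne B n x (by omega), map_zero]
    exact dif_neg h

theorem coefY_incl (m : ℤ) (w : Bc B n x y m →₀ ℚ) : coefY B n y m (incl B n x y m w) = 0 := by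
  by_cases h : m = n
  · subst h
    rw [coefY_self]
    exact subIncl_apply_of_not_mem _ w fun hy => hy.2 rfl rfl
  · rw [coefY_of_ne B n y h, LinearMap.zero_apply]

theorem coefY_xAt (m : ℤ) : coefY B n y m (xAt B n x m) = 0 := by
  by_cases h : m = n
  · rw [xAt_of_ne B n x (by omega), map_zero]
  · rw [coefY_of_ne B n y h, LinearMap.zero_apply]

theorem proj_xAt (m : ℤ) : proj B n x y m (xAt B n x m) = 0 := by
  by_cases h : m = n + 1
  · subst h
    rw [xAt_self]
    exact Finsupp.ext fun b => Finsupp.single_eq_of_ne (b.2.1 rfl)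
  · rw [xAt_of_ne B n x h, map_zero]

theorem yToX_incl (m : ℤ) (w : Bc B n x y m →₀ ℚ) : yToX B n x y m (incl B n x y m w) = 0 := by
  rw [yToX_apply, coefY_incl, zero_smul]

theorem yToX_yToX (m : ℤ) (v : B m →₀ ℚ) : yToX B n x y (m + 1) (yToX B n x y m v) = 0 := by
  rw [yToX_apply, yToX_apply B n x y m, map_smul, coefY_xAt, smul_zero, zero_smul]

theorem proj_yToX (m : ℤ) (v : B m →₀ ℚ) : proj B n x y (m + 1) (yToX B n x y m v) = 0 := by
  rw [yToX_apply, map_smul, proj_xAt, smul_zero]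

theorem proj_incl (m : ℤ) (w : Bc B n x y m →₀ ℚ) : proj B n x y m (incl B n x y m w) = w :=
  LinearMap.congr_fun (subProj_comp_subIncl _) w

variable {d} in
theorem yToX_d_yToX {n : ℤ} {x : B (n + 1)} {y : B n} (hxy : d n (Finsupp.single x 1) y = 1)
    (m : ℤ) (v : B m →₀ ℚ) : yToX B n x y m (d m (yToX B n x y m v)) = yToX B n x y m v := by
  by_cases h : m = n
  · subst h
    simp only [yToX_apply, map_smul, xAt_self, coefY_self, hxy, one_smul]
  · simp only [yToX_apply, coefY_of_ne B n y h, LinearMap.zero_apply, zero_smul]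

/-- A vector without `y`-coordinate differs from its projection by a multiple of `x`. -/
theorem exists_incl_proj (m : ℤ) (u : B (m + 1) →₀ ℚ) (hu : yToX B n x y (m + 1) u = 0) :
    ∃ w, incl B n x y (m + 1) (proj B n x y (m + 1) u) = u - yToX B n x y m w := by
  have key : ∀ v : B (m + 1) →₀ ℚ,
      (∀ b, ((∀ h : m + 1 = n + 1, bcast B h b ≠ x) ∧ (∀ h : m + 1 = n, bcast B h b ≠ y)) →
        v b = u b) →
      (∀ b, ¬ ((∀ h : m + 1 = n + 1, bcast B h b ≠ x) ∧ (∀ h : m + 1 = n, bcast B h b ≠ y)) →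
        v b = 0) → incl B n x y (m + 1) (proj B n x y (m + 1) u) = v := by
    intro v h1 h2
    refine Finsupp.ext fun b => ?_
    by_cases hb : (∀ h : m + 1 = n + 1, bcast B h b ≠ x) ∧ (∀ h : m + 1 = n, bcast B h b ≠ y)
    · rw [h1 b hb]
      exact subIncl_apply_of_mem
        (fun b => (∀ h : m + 1 = n + 1, bcast B h b ≠ x) ∧ (∀ h : m + 1 = n, bcast B h b ≠ y))
        _ ⟨b, hb⟩
    · rw [h2 b hb]
      exact subIncl_apply_of_not_mem _ _ hb
  by_cases hm : m = n
  · subst hm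
    refine ⟨Finsupp.single y (u x), key _ (fun b hb => ?_) (fun b hb => ?_)⟩
    · have : b ≠ x := hb.1 rfl
      simp [yToX_apply, coefY_self, xAt_self, this]
    · obtain rfl : b = x := by
        by_contra hne
        exact hb ⟨fun _ => hne, fun h => by clear hb; omega⟩
      simp [yToX_apply, coefY_self, xAt_self]
  · refine ⟨0, key _ (fun b _ => by simp) (fun b hb => ?_)⟩
    rw [map_zero, sub_zero]
    by_cases hn : m + 1 = n
    · subst hn
      obtain rfl : b = y := by
        by_contra hne
        exact hb ⟨fun h => by clear hb; omega, fun _ => hne⟩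
      rw [yToX_apply, coefY_self, xAt_self] at hu
      simpa using DFunLike.congr_fun hu x
    · exact (hb ⟨fun h => by clear hb; omega, fun h => absurd h hn⟩).elim

/-- The retraction `C → C′`, `v ↦ P (v − v_y • d x)`. -/
def cancelMap (m : ℤ) : (B m →₀ ℚ) →ₗ[ℚ] (Bc B n x y m →₀ ℚ) :=
  proj B n x y m ∘ₗ (LinearMap.id - d m ∘ₗ yToX B n x y m)

/-- The section `C′ → C`, `w ↦ w − (d w)_y • x`. -/
def cancelSection (m : ℤ) : (Bc B n x y (m + 1) →₀ ℚ) →ₗ[ℚ] (B (m + 1) →₀ ℚ) :=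
  (LinearMap.id - yToX B n x y m ∘ₗ d m) ∘ₗ incl B n x y (m + 1)

theorem d'_eq (m : ℤ) :
    d' B d n x y m = cancelMap B d n x y m ∘ₗ d m ∘ₗ incl B n x y (m + 1) := by
  refine LinearMap.ext fun w => ?_
  simp only [d', cancelMap, LinearMap.comp_apply, LinearMap.sub_apply, LinearMap.id_apply,
    yToX_apply, dxAt_eq, LinearMap.toSpanSingleton_apply, map_smul]

section Identities

variable {d n x y}
variable (hd : ∀ m : ℤ, (d m).comp (d (m + 1)) = 0) (hxy : d n (Finsupp.single x 1) y = 1)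

theorem cancelMap_comp_cancelSection (m : ℤ) :
    cancelMap B d n x y (m + 1) ∘ₗ cancelSection B d n x y m = LinearMap.id := by
  refine LinearMap.ext fun w => ?_
  simp only [cancelMap, cancelSection, LinearMap.comp_apply, LinearMap.sub_apply,
    LinearMap.id_apply, map_sub, yToX_incl, yToX_yToX, proj_yToX, proj_incl, map_zero, sub_zero]

include hd hxy

theorem d'_comp_cancelMap (m : ℤ) :
    d' B d n x y m ∘ₗ cancelMap B d n x y (m + 1) = cancelMap B d n x y m ∘ₗ d m := by
  refine LinearMap.ext fun v => ?_
  have hdd (w) : d m (d (m + 1) w) = 0 := LinearMap.congr_fun (hd m) w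
  obtain ⟨z, hz⟩ := exists_incl_proj B n x y m (v - d (m + 1) (yToX B n x y (m + 1) v))
    (by rw [map_sub, yToX_d_yToX B hxy, sub_self])
  rw [d'_eq]
  simp only [LinearMap.comp_apply, cancelMap, LinearMap.sub_apply, LinearMap.id_apply]
  rw [hz]
  simp only [map_sub, yToX_d_yToX B hxy, hdd, sub_zero]
  abel

theorem d_comp_cancelSection (m : ℤ) :
    d (m + 1) ∘ₗ cancelSection B d n x y (m + 1) =
      cancelSection B d n x y m ∘ₗ d' B d n x y (m + 1) := by
  refine LinearMap.ext fun w => ?_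
  have hdd (w) : d m (d (m + 1) w) = 0 := LinearMap.congr_fun (hd m) w
  obtain ⟨z, hz⟩ := exists_incl_proj B n x y m
    (d (m + 1) (incl B n x y _ w) -
      d (m + 1) (yToX B n x y (m + 1) (d (m + 1) (incl B n x y _ w))))
    (by rw [map_sub, yToX_d_yToX B hxy, sub_self])
  rw [d'_eq]
  simp only [LinearMap.comp_apply, cancelMap, cancelSection, LinearMap.sub_apply,
    LinearMap.id_apply]
  rw [hz]
  simp only [map_sub, map_neg, yToX_d_yToX B hxy, hdd, sub_zero, zero_sub]
  abel

theorem cancelSection_comp_cancelMap (m : ℤ) :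
    cancelSection B d n x y m ∘ₗ cancelMap B d n x y (m + 1) +
      (d (m + 1) ∘ₗ yToX B n x y (m + 1) + yToX B n x y m ∘ₗ d m) = LinearMap.id := by
  refine LinearMap.ext fun v => ?_
  have hdd (w) : d m (d (m + 1) w) = 0 := LinearMap.congr_fun (hd m) w
  obtain ⟨z, hz⟩ := exists_incl_proj B n x y m (v - d (m + 1) (yToX B n x y (m + 1) v))
    (by rw [map_sub, yToX_d_yToX B hxy, sub_self])
  simp only [LinearMap.comp_apply, cancelMap, cancelSection, LinearMap.add_apply,
    LinearMap.sub_apply, LinearMap.id_apply]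
  rw [hz]
  simp only [map_sub, yToX_d_yToX B hxy, hdd, sub_zero]
  abel

end Identities

section Graded

variable {d n x y gr}

theorem isGraded_yToX (hg : gr n y = gr (n + 1) x) (m : ℤ) :
    IsGraded (gr m) (gr (m + 1)) (yToX B n x y m) := by
  intro a c h
  by_cases hm : m = n
  · subst hm
    rw [yToX_apply, coefY_self, xAt_self, Finsupp.smul_apply]
    by_cases ha : a = y
    · rw [Finsupp.single_eq_of_ne (a := x) (a' := c), smul_zero]
      rintro rfl
      exact h (by rw [ha, hg])
    · rw [Finsupp.single_eq_of_ne (Ne.symm ha), zero_smul]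
  · rw [yToX_apply, coefY_of_ne B n y hm, LinearMap.zero_apply, zero_smul, Finsupp.zero_apply]

theorem isGraded_incl (m : ℤ) :
    IsGraded (fun b : Bc B n x y m => gr m b.1) (gr m) (incl B n x y m) :=
  isGraded_subIncl _

theorem isGraded_proj (m : ℤ) :
    IsGraded (gr m) (fun b : Bc B n x y m => gr m b.1) (proj B n x y m) :=
  isGraded_subProj _

variable (hdg : ∀ m, IsGraded (gr (m + 1)) (gr m) (d m)) (hg : gr n y = gr (n + 1) x)
include hdg hg

theorem isGraded_cancelMap (m : ℤ) :
    IsGraded (gr m) (fun b : Bc B n x y m => gr m b.1) (cancelMap B d n x y m) :=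
  (isGraded_proj B m).comp (isGraded_id.sub ((hdg m).comp (isGraded_yToX B hg m)))

theorem isGraded_cancelSection (m : ℤ) :
    IsGraded (fun b : Bc B n x y (m + 1) => gr (m + 1) b.1) (gr (m + 1))
      (cancelSection B d n x y m) :=
  (isGraded_id.sub ((isGraded_yToX B hg m).comp (hdg m))).comp (isGraded_incl B (m + 1))

theorem isGraded_d' (m : ℤ) :
    IsGraded (fun b : Bc B n x y (m + 1) => gr (m + 1) b.1) (fun b : Bc B n x y m => gr m b.1)
      (d' B d n x y m) := by
  rw [d'_eq]
  exact (isGraded_cancelMap B hdg hg m).comp ((hdg m).comp (isGraded_incl B (m + 1)))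

end Graded

/-- Graded cancellation: if the based chain complex `(C, d)` carries an auxiliary `ℤ²`-grading
in which every basis element is homogeneous and which is preserved by `d`, and `x ∈ B_{n+1}`,
`y ∈ B_n` satisfy `(d x)_y = 1`, then `y` has the same bidegree as `x`, the cancelled complex
`(C′, d′)` inherits the auxiliary grading (`d′` preserves the grading), and for every degree and
every bidegree `(j,k)` the homology of the `(j,k)`-graded subcomplex of `C` is isomorphic to the
homology of the `(j,k)`-graded subcomplex of `C′`. -/
theorem graded_cancellation
    [∀ m : ℤ, Fintype (B m)]
    (hd : ∀ m : ℤ, (d m).comp (d (m + 1)) = 0)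
    (hpres : ∀ (m : ℤ) (b : B (m + 1)) (c : B m),
      gr m c ≠ gr (m + 1) b → d m (Finsupp.single b 1) c = 0)
    (hxy : d n (Finsupp.single x 1) y = 1) :
    gr n y = gr (n + 1) x ∧
    (∀ (m : ℤ) (a : Bc B n x y (m + 1)) (c : Bc B n x y m),
      gr m c.1 ≠ gr (m + 1) a.1 → d' B d n x y m (Finsupp.single a 1) c = 0) ∧
    (∀ (m : ℤ) (jk : ℤ × ℤ),
      Nonempty ((homologyOf (dG B d gr jk (m + 1)) (dG B d gr jk m)) ≃ₗ[ℚ]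
        (homologyOf (dG' B d n x y gr jk (m + 1)) (dG' B d n x y gr jk m)))) := by
  have hg : gr n y = gr (n + 1) x := by
    by_contra h
    rw [hpres n x y h] at hxy
    exact zero_ne_one hxy
  have hF := isGraded_cancelMap B hpres hg
  have hG := isGraded_cancelSection B hpres hg
  have hd' := isGraded_d' B hpres hg
  have hS := isGraded_yToX B hg
  refine ⟨hg, hd', fun m jk => ?_⟩
  obtain ⟨m, rfl⟩ : ∃ k, m = k + 1 := ⟨m - 1, by ring⟩
  let gr' (m : ℤ) (b : Bc B n x y m) : ℤ × ℤ := gr m b.1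
  let F (m : ℤ) := gradedRestrict (gr m) (gr' m) jk (cancelMap B d n x y m)
  let G (m : ℤ) := gradedRestrict (gr' (m + 1)) (gr (m + 1)) jk (cancelSection B d n x y m)
  let S (m : ℤ) := gradedRestrict (gr m) (gr (m + 1)) jk (yToX B n x y m)
  let D (m : ℤ) := gradedRestrict (gr (m + 1)) (gr m) jk (d m)
  let D' (m : ℤ) := gradedRestrict (gr' (m + 1)) (gr' m) jk (d' B d n x y m)
  have hFD (m : ℤ) : D' m ∘ₗ F (m + 1) = F m ∘ₗ D m := by
    rw [← gradedRestrict_comp jk _ (hF _), ← gradedRestrict_comp jk _ (hpres _),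
      d'_comp_cancelMap B hd hxy]
  have hGD (m : ℤ) : D (m + 1) ∘ₗ G (m + 1) = G m ∘ₗ D' (m + 1) := by
    rw [← gradedRestrict_comp jk _ (hG _), ← gradedRestrict_comp jk _ (hd' _),
      d_comp_cancelSection B hd hxy]
  have hFG (m : ℤ) : F (m + 1) ∘ₗ G m = LinearMap.id := by
    rw [← gradedRestrict_comp jk _ (hG _), cancelMap_comp_cancelSection, gradedRestrict_id]
  have hGF (m : ℤ) : G m ∘ₗ F (m + 1) + (D (m + 1) ∘ₗ S (m + 1) + S m ∘ₗ D m) =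
      LinearMap.id := by
    rw [← gradedRestrict_comp jk _ (hF _), ← gradedRestrict_comp jk _ (hS _),
      ← gradedRestrict_comp jk _ (hpres _), ← gradedRestrict_add, ← gradedRestrict_add,
      cancelSection_comp_cancelMap B hd hxy, gradedRestrict_id]
  exact nonempty_homologyOf_equiv (F _) (F _) (F _) (G _) (G _) (G _) (S _) (S _)
    (hFD _).symm (hFD _) (hGD _).symm (hGD _) (hFG _) (hGF _)
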